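/- arXiv:2406.13000 — 4 statements merged into one kernel-verified Lean document; each statement's English description precedes it below -/
import Mathlib

section
/- Let b ≥ 1 be an integer, let N ≥ 50b, let Δ be sufficiently large, and let G be a graph with maximum degree at most Δ on n ≤ 2^{Δ/N} vertices; set m = ⌊nΔ/2⌋. Partition the positions {1,…,m} into b blocks, where block r consists of those i with ⌈i·b/m⌉ = r. Then the fraction of injections σ : E(G) → {1,…,m} for which there exist a vertex v and a block r such that more than 2Δ/b edges of G incident to v receive positions in block r is at most exp(−Δ/(20b)). -/
open scoped Classical

theorem Nat.descFactorial_mul_pow_le {s m : ℕ} (h : s ≤ m) (k : ℕ) :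
    s.descFactorial k * m ^ k ≤ s ^ k * m.descFactorial k := by
  induction k with
  | zero => simp
  | succ k ih =>
    have h1 : (s - k) * m ≤ s * (m - k) := by
      rw [Nat.sub_mul, Nat.mul_sub]
      exact Nat.sub_le_sub_left (by rw [mul_comm s k]; exact Nat.mul_le_mul_left k h) _
    calc s.descFactorial (k + 1) * m ^ (k + 1)
        = ((s - k) * m) * (s.descFactorial k * m ^ k) := by
          rw [Nat.descFactorial_succ]; ring
      _ ≤ (s * (m - k)) * (s ^ k * m.descFactorial k) := Nat.mul_le_mul h1 ih
      _ = s ^ (k + 1) * m.descFactorial (k + 1) := by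
          rw [Nat.descFactorial_succ]; ring


theorem card_filter_embedding_mapsTo_le {α β : Type*} [Fintype α] [Fintype β] [DecidableEq β]
    [Fintype (α ↪ β)]
    (S : Finset α) (B : Finset β) :
    (Finset.univ.filter fun σ : α ↪ β => ∀ e ∈ S, σ e ∈ B).card * Fintype.card β ^ S.card ≤
      B.card ^ S.card * Fintype.card (α ↪ β) := by
  let eqv : (α ↪ β) ≃ Σ f : {a // a ∈ S} ↪ β, {a // a ∉ S} ↪ ↥(Set.range f)ᶜ :=
    ((Equiv.sumCompl (· ∈ S)).symm.embeddingCongr (Equiv.refl β)).trans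
      Equiv.sumEmbeddingEquivSigmaEmbeddingRestricted
  have heqv : ∀ σ e, (eqv σ).1 e = σ e := fun σ e => rfl
  set c := (Fintype.card β - S.card).descFactorial (Fintype.card {a // a ∉ S}) with hc
  have hfib : ∀ f : {a // a ∈ S} ↪ β, Fintype.card ({a // a ∉ S} ↪ ↥(Set.range f)ᶜ) = c := by
    intro f
    rw [Fintype.card_embedding_eq, hc, Fintype.card_compl_set, Set.card_range_of_injective f.injective]
    simp
  have htot : Fintype.card (α ↪ β) = (Fintype.card β).descFactorial S.card * c := by
    rw [Fintype.card_congr eqv, Fintype.card_sigma, Finset.sum_congr rfl fun f _ => hfib f]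
    simp [Fintype.card_embedding_eq]
  have hS : (Finset.univ.filter fun σ : α ↪ β => ∀ e ∈ S, σ e ∈ B).card =
      B.card.descFactorial S.card * c := by
    let T := Finset.univ.filter fun f : {a // a ∈ S} ↪ β => ∀ e, f e ∈ B
    have hT : T.card = B.card.descFactorial S.card := by
      have : Fintype.card ({a // a ∈ S} ↪ {x // x ∈ B}) = T.card := by
        rw [← Fintype.card_coe T]
        refine Fintype.card_congr ⟨fun f => ⟨f.trans (Function.Embedding.subtype _), by simp [T]⟩,
          fun f => f.1.codRestrict B (Finset.mem_filter.1 f.2).2, fun f => ?_, fun f => ?_⟩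
        · ext; rfl
        · ext; rfl
      rw [← this, Fintype.card_embedding_eq]; simp
    rw [← hT]
    have : (Finset.univ.filter fun σ : α ↪ β => ∀ e ∈ S, σ e ∈ B).card =
        (T.sigma fun f => (Finset.univ : Finset ({a // a ∉ S} ↪ ↥(Set.range f)ᶜ))).card := by
      refine Finset.card_equiv eqv fun σ => ?_
      simp [T, heqv]
    rw [this, Finset.card_sigma]
    simp only [Finset.card_univ, hfib]
    simp
  rw [hS, htot]
  calc _ = (B.card.descFactorial S.card * Fintype.card β ^ S.card) * c := by ring
    _ ≤ (B.card ^ S.card * (Fintype.card β).descFactorial S.card) * c :=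
      Nat.mul_le_mul_right _ (Nat.descFactorial_mul_pow_le (Finset.card_le_univ B) _)
    _ = _ := by ring

theorem sum_two_pow_card_filter_embedding_le {α β : Type*} [Fintype α] [Fintype β] [DecidableEq β]
    [Fintype (α ↪ β)] [Nonempty β]
    (A : Finset α) (B : Finset β) :
    ∑ σ : α ↪ β, (2 : ℝ) ^ (A.filter fun e => σ e ∈ B).card ≤
      (1 + (B.card : ℝ) / Fintype.card β) ^ A.card * Fintype.card (α ↪ β) := by
  have hpos : (0 : ℝ) < Fintype.card β := by exact_mod_cast Fintype.card_pos
  have h1 : ∀ σ : α ↪ β, (2 : ℝ) ^ (A.filter fun e => σ e ∈ B).card =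
      ∑ S ∈ A.powerset, if ∀ e ∈ S, σ e ∈ B then (1 : ℝ) else 0 := by
    intro σ
    rw [Finset.sum_boole]
    have : (A.powerset.filter fun S => ∀ e ∈ S, σ e ∈ B) =
        (A.filter fun e => σ e ∈ B).powerset := by
      ext S
      simp only [Finset.mem_filter, Finset.mem_powerset, Finset.subset_iff]
      grind
    rw [this, Finset.card_powerset]; norm_num
  rw [Finset.sum_congr rfl fun σ _ => h1 σ, Finset.sum_comm, add_comm (1 : ℝ),
    ← Finset.sum_pow_mul_eq_add_pow, Finset.sum_mul]
  refine Finset.sum_le_sum fun S _ => ?_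
  rw [Finset.sum_boole, one_pow, mul_one, div_pow, div_mul_eq_mul_div, le_div_iff₀ (by positivity)]
  exact_mod_cast card_filter_embedding_mapsTo_le S B

theorem card_filter_lt_card_filter_embedding_le {α β : Type*} [Fintype α] [Fintype β] [DecidableEq β]
    [Fintype (α ↪ β)] [Nonempty β]
    (A : Finset α) (B : Finset β) (t : ℝ) :
    ((Finset.univ.filter fun σ : α ↪ β => t < (A.filter fun e => σ e ∈ B).card).card : ℝ) ≤
      Real.exp (A.card * (B.card / Fintype.card β) - t * Real.log 2) *
        Fintype.card (α ↪ β) := by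
  have hM : ((Finset.univ.filter fun σ : α ↪ β => t < (A.filter fun e => σ e ∈ B).card).card : ℝ) *
      Real.exp (t * Real.log 2) ≤ ∑ σ : α ↪ β, (2 : ℝ) ^ (A.filter fun e => σ e ∈ B).card := by
    rw [← nsmul_eq_mul]
    refine (Finset.card_nsmul_le_sum _ _ _ fun σ hσ => ?_).trans
      (Finset.sum_le_sum_of_subset_of_nonneg (Finset.subset_univ _) fun _ _ _ => by positivity)
    rw [← Real.rpow_natCast, Real.rpow_def_of_pos two_pos, mul_comm t]
    gcongr
    exact (Finset.mem_filter.1 hσ).2.le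
  rw [Real.exp_sub, div_mul_eq_mul_div, le_div_iff₀ (Real.exp_pos _)]
  refine hM.trans ((sum_two_pow_card_filter_embedding_le A B).trans ?_)
  gcongr
  rw [Real.exp_nat_mul]
  gcongr
  rw [add_comm]
  exact Real.add_one_le_exp _

theorem card_filter_ceil_eq_le {m b : ℕ} (hm : 0 < m) (hb : 0 < b) (r : ℤ) :
    ((Finset.univ.filter fun i : Fin m =>
      ⌈(((i : ℕ) + 1 : ℕ) : ℝ) * (b : ℝ) / (m : ℝ)⌉ = r).card : ℝ) ≤ m / b + 1 := by
  have hm' : (0 : ℝ) < m := by exact_mod_cast hm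
  have hb' : (0 : ℝ) < b := by exact_mod_cast hb
  have hle : (Finset.univ.filter fun i : Fin m =>
      ⌈(((i : ℕ) + 1 : ℕ) : ℝ) * (b : ℝ) / (m : ℝ)⌉ = r).card ≤
      (Finset.Ioc ⌊(r - 1 : ℝ) * m / b⌋ ⌊(r : ℝ) * m / b⌋).card := by
    refine Finset.card_le_card_of_injOn (fun i => ((i : ℕ) : ℤ) + 1) (fun i hi => ?_) ?_
    · have hi := (Finset.mem_filter.1 hi).2
      rw [Int.ceil_eq_iff, lt_div_iff₀ hm', div_le_iff₀ hm'] at hi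
      push_cast at hi
      simp only [Finset.coe_Ioc, Set.mem_Ioc, Int.floor_lt, Int.le_floor]
      push_cast
      rw [div_lt_iff₀ hb', le_div_iff₀ hb']
      exact hi
    · intro i _ j _ hij
      simp at hij
      exact Fin.ext hij
  rw [Int.card_Ioc] at hle
  have h1 := Int.floor_le ((r : ℝ) * m / b)
  have h2 := Int.lt_floor_add_one ((r - 1 : ℝ) * m / b)
  have h3 : (r - 1 : ℝ) * m / b = r * m / b - m / b := by ring
  have h4 : (0 : ℝ) ≤ m / b := by positivity
  have h5 : (((⌊(r : ℝ) * m / b⌋ - ⌊(r - 1 : ℝ) * m / b⌋).toNat : ℤ) : ℝ) ≤ m / b + 1 := by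
    rw [Int.toNat_eq_max]
    push_cast
    refine max_le (by linarith) (by positivity)
  exact (Nat.cast_le.2 hle).trans (by exact_mod_cast h5)

theorem SimpleGraph.card_filter_mem_edgeSet {V : Type*} (G : SimpleGraph V) (v : V)
    [Fintype G.edgeSet] [DecidablePred fun e : G.edgeSet => v ∈ (e : Sym2 V)] :
    (Finset.univ.filter fun e : G.edgeSet => v ∈ (e : Sym2 V)).card = (G.neighborSet v).ncard := by
  rw [← Nat.card_coe_set_eq, ← Nat.card_congr (G.incidenceSetEquivNeighborSet v),
    ← Fintype.card_subtype, ← Nat.card_eq_fintype_card]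
  refine Nat.card_congr ?_
  exact (Equiv.subtypeSubtypeEquivSubtypeInter (· ∈ G.edgeSet) (fun e => v ∈ e))

/-- **Balance of the random-order phase partition.** Let `b ≥ 1`, `N ≥ 50b`,
let `Δ` be sufficiently large, and let `G` be a graph on `n ≤ 2^{Δ/N}`
vertices with maximum degree at most `Δ`; set `m = ⌊nΔ/2⌋`. Partition the
positions `{1,…,m}` into `b` blocks, position `i` lying in block `⌈i·b/m⌉`.
Then the fraction of injections `σ : E(G) → {1,…,m}` for which some vertex
`v` and block `r` see more than `2Δ/b` edges incident to `v` placed in block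
`r` is at most `exp(−Δ/(20b))`. -/
theorem stmt_4 (b : ℕ) (hb : 1 ≤ b) (N : ℝ) (hN : 50 * (b : ℝ) ≤ N) :
    ∃ Δ₀ : ℕ, ∀ Δ : ℕ, Δ₀ ≤ Δ → ∀ n : ℕ, (n : ℝ) ≤ 2 ^ ((Δ : ℝ) / N) →
      ∀ G : SimpleGraph (Fin n), (∀ v, (G.neighborSet v).ncard ≤ Δ) →
        ((Finset.univ.filter fun σ : G.edgeSet ↪ Fin (n * Δ / 2) =>
            ∃ (v : Fin n) (r : ℕ),
              2 * (Δ : ℝ) / (b : ℝ) <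
                ((Finset.univ.filter fun e : G.edgeSet =>
                    v ∈ (e : Sym2 (Fin n)) ∧
                      ⌈((((σ e : Fin (n * Δ / 2)) : ℕ) + 1 : ℕ) : ℝ) * (b : ℝ) /
                          ((n * Δ / 2 : ℕ) : ℝ)⌉ = (r : ℤ)).card : ℝ)).card : ℝ) ≤
          Real.exp (-(Δ : ℝ) / (20 * (b : ℝ))) *
            (Fintype.card (G.edgeSet ↪ Fin (n * Δ / 2)) : ℝ) := by
  refine ⟨10 * b * (b + 3), fun Δ hΔ n hn G hG => ?_⟩
  have hb1 : (1 : ℝ) ≤ b := by exact_mod_cast hb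
  have hb0 : (0 : ℝ) < b := by linarith
  have hΔb : b + 3 ≤ (Δ : ℝ) / b * (1 / 10) := by
    have : (10 * b * (b + 3) : ℝ) ≤ Δ := by exact_mod_cast hΔ
    rw [div_mul_eq_mul_div, le_div_iff₀ hb0]
    linarith
  have hΔ40 : 40 ≤ Δ := by nlinarith
  rcases Nat.eq_zero_or_pos n with rfl | hn0
  · simp only [IsEmpty.exists_iff, Finset.filter_false, Finset.card_empty, Nat.cast_zero]
    positivity
  set m := n * Δ / 2
  have hmΔ : Δ ≤ 3 * m := by
    have : Δ ≤ n * Δ := Nat.le_mul_of_pos_left _ hn0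
    omega
  have hm0 : 0 < m := by omega
  have hm0' : (0 : ℝ) < m := by exact_mod_cast hm0
  have : Nonempty (Fin m) := ⟨⟨0, hm0⟩⟩
  set block : Fin m → ℤ := fun i => ⌈(((i : ℕ) + 1 : ℕ) : ℝ) * (b : ℝ) / (m : ℝ)⌉ 
  have hblock_mem : ∀ i, 1 ≤ block i ∧ block i ≤ b := by
    intro i
    constructor
    · rw [Int.one_le_ceil_iff]; positivity
    · rw [Int.ceil_le, div_le_iff₀ hm0', mul_comm]
      have : (((i : ℕ) + 1 : ℕ) : ℝ) ≤ m := by exact_mod_cast i.2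
      push_cast at this ⊢
      gcongr
  let bad : Fin n → ℕ → Finset (G.edgeSet ↪ Fin m) := fun v r =>
    Finset.univ.filter fun σ => 2 * (Δ : ℝ) / b <
      (((Finset.univ.filter fun e : G.edgeSet => v ∈ (e : Sym2 (Fin n))).filter fun e =>
        σ e ∈ Finset.univ.filter fun i => block i = r).card : ℝ)
  set T : ℝ := ((Fintype.card (G.edgeSet ↪ Fin m) : ℕ) : ℝ)
  have hbad : ∀ v r, ((bad v r).card : ℝ) ≤
      Real.exp ((Δ : ℝ) / b + 3 - 2 * Δ / b * Real.log 2) * T := by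
    intro v r
    refine (card_filter_lt_card_filter_embedding_le _ _ _).trans ?_
    rw [Fintype.card_fin, G.card_filter_mem_edgeSet]
    gcongr
    have h1 : ((Finset.univ.filter fun i => block i = r).card : ℝ) / m ≤ 1 / b + 1 / m := by
      rw [div_le_iff₀ hm0', add_mul, one_div_mul_cancel hm0'.ne', one_div_mul_eq_div]
      exact card_filter_ceil_eq_le hm0 hb r
    have h2 : ((G.neighborSet v).ncard : ℝ) ≤ Δ := by exact_mod_cast hG v
    have h3 : (Δ : ℝ) / m ≤ 3 := by
      rw [div_le_iff₀ hm0']; exact_mod_cast hmΔ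
    calc _ ≤ (Δ : ℝ) * (1 / b + 1 / m) := by gcongr
      _ = (Δ : ℝ) / b + Δ / m := by ring
      _ ≤ _ := by linarith
  have hsub : (Finset.univ.filter fun σ : G.edgeSet ↪ Fin m => ∃ (v : Fin n) (r : ℕ),
      2 * (Δ : ℝ) / b < ((Finset.univ.filter fun e : G.edgeSet =>
        v ∈ (e : Sym2 (Fin n)) ∧ block (σ e) = r).card : ℝ)) ⊆
      ((Finset.univ : Finset (Fin n)) ×ˢ Finset.Icc 1 b).biUnion fun p => bad p.1 p.2 := by
    intro σ hσ
    obtain ⟨v, r, hvr⟩ := (Finset.mem_filter.1 hσ).2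
    have hr : 1 ≤ r ∧ r ≤ b := by
      have h0 : (0 : ℝ) < _ := lt_of_le_of_lt (by positivity) hvr
      obtain ⟨e, he⟩ := Finset.card_pos.1 (Nat.cast_pos.1 h0)
      have := hblock_mem (σ e)
      rw [(Finset.mem_filter.1 he).2.2] at this
      exact_mod_cast this
    refine Finset.mem_biUnion.2 ⟨(v, r), by simp [hr], ?_⟩
    simpa [bad, Finset.filter_filter] using hvr
  have hcount : ((Finset.univ.filter fun σ : G.edgeSet ↪ Fin m => ∃ (v : Fin n) (r : ℕ),
      2 * (Δ : ℝ) / b < ((Finset.univ.filter fun e : G.edgeSet =>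
        v ∈ (e : Sym2 (Fin n)) ∧ block (σ e) = r).card : ℝ)).card : ℝ) ≤
      n * b * (Real.exp ((Δ : ℝ) / b + 3 - 2 * Δ / b * Real.log 2) * T) := by
    refine (Nat.cast_le.2 ((Finset.card_le_card hsub).trans Finset.card_biUnion_le)).trans ?_
    push_cast
    refine (Finset.sum_le_card_nsmul _ _ _ fun p _ => hbad p.1 p.2).trans (le_of_eq ?_)
    simp [Finset.card_product]
  refine hcount.trans ?_
  have hlog := Real.log_two_gt_d9
  have hn' : (n : ℝ) ≤ Real.exp (Real.log 2 * ((Δ : ℝ) / b * (1 / 50))) := by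
    refine hn.trans ?_
    rw [Real.rpow_def_of_pos two_pos]
    gcongr
    calc (Δ : ℝ) / N ≤ Δ / (50 * b) := by gcongr
      _ = _ := by ring
  have hb' : (b : ℝ) ≤ Real.exp b := by linarith [Real.add_one_le_exp (b : ℝ)]
  calc _ ≤ Real.exp (Real.log 2 * ((Δ : ℝ) / b * (1 / 50))) * Real.exp b *
        (Real.exp ((Δ : ℝ) / b + 3 - 2 * Δ / b * Real.log 2) * T) := by gcongr
    _ = Real.exp (Real.log 2 * ((Δ : ℝ) / b * (1 / 50)) + b +
        ((Δ : ℝ) / b + 3 - 2 * Δ / b * Real.log 2)) * T := by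
      rw [Real.exp_add, Real.exp_add]; ring
    _ ≤ _ := by
      gcongr
      have e1 : -(Δ : ℝ) / (20 * b) = -(Δ / b * (1 / 20)) := by ring
      have e2 : 2 * (Δ : ℝ) / b = 2 * (Δ / b) := by ring
      rw [e1, e2]
      have : (0 : ℝ) ≤ Δ / b := by positivity
      nlinarith
end

section
/- (Freedman's inequality, simplified form.) Let (Ω, ℱ, P) be a probability space with a filtration ℱ₀ ⊆ ℱ₁ ⊆ … ⊆ ℱ_m, and let (Y_i)_{i=0}^{m} be a supermartingale with respect to this filtration whose difference sequence D_i = Y_i − Y_{i−1} satisfies |D_i| ≤ D almost surely for all i, for some constant D > 0. Let V_i = Var(D_i ∣ ℱ_{i−1}) denote the conditional variance of D_i given ℱ_{i−1}, and W_i = ∑_{j ≤ i} V_j. If W_m ≤ b almost surely, then for every δ > 0, P(Y_m ≥ Y₀ + δ) ≤ exp(−δ² / (2(D·δ/3 + b))). -/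
open MeasureTheory

/-- The exponential is below its second-order Taylor polynomial on the nonpositive reals. -/
lemma Real.exp_le_quadratic_of_nonpos {y : ℝ} (hy : y ≤ 0) :
    Real.exp y ≤ 1 + y + y ^ 2 / 2 := by
  have h := Real.quadratic_le_exp_of_nonneg (neg_nonneg.2 hy)
  have hmul : Real.exp y * Real.exp (-y) = 1 := by rw [← Real.exp_add]; simp
  have hq : 0 < 1 + y + y ^ 2 / 2 := by nlinarith [sq_nonneg (y + 1)]
  by_contra! hlt
  have : (1 + y + y ^ 2 / 2) * (1 + -y + (-y) ^ 2 / 2) < 1 :=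
    calc _ ≤ (1 + y + y ^ 2 / 2) * Real.exp (-y) := by gcongr
      _ < Real.exp y * Real.exp (-y) := by gcongr
      _ = 1 := hmul
  nlinarith [sq_nonneg (y ^ 2)]

/-- A Padé upper bound for the exponential on the nonnegative reals. -/
lemma Real.exp_mul_six_sub_le {y : ℝ} (hy : 0 ≤ y) :
    Real.exp y * (6 - 2 * y) ≤ 6 + 4 * y + y ^ 2 := by
  let g : ℝ → ℝ := fun y => Real.exp (-y) * (6 + 4 * y + y ^ 2) - (6 - 2 * y)
  have hg : ∀ x, HasDerivAt g (2 - Real.exp (-x) * (x ^ 2 + 2 * x + 2)) x := fun x => by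
    have h1 : HasDerivAt (fun y : ℝ => Real.exp (-y)) (Real.exp (-x) * -1) x :=
      (hasDerivAt_neg x).exp
    have h2 : HasDerivAt (fun y : ℝ => 6 + 4 * y + y ^ 2) (4 * 1 + 2 * x) x := by
      have h := (((hasDerivAt_id x).const_mul 4).const_add 6).add (hasDerivAt_pow 2 x)
      exact h.congr_deriv (by simp)
    have h3 : HasDerivAt (fun y : ℝ => 6 - 2 * y) (-(2 * 1)) x :=
      ((hasDerivAt_id x).const_mul 2).const_sub 6
    exact ((h1.mul h2).sub h3).congr_deriv (by ring)
  have hmono : MonotoneOn g (Set.Ici 0) := by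
    refine monotoneOn_of_deriv_nonneg (convex_Ici 0)
      (fun x _ => (hg x).continuousAt.continuousWithinAt)
      (fun x _ => (hg x).differentiableAt.differentiableWithinAt) fun x hx => ?_
    rw [interior_Ici, Set.mem_Ioi] at hx
    rw [(hg x).deriv, Real.exp_neg, sub_nonneg, inv_mul_le_iff₀ (Real.exp_pos x)]
    linarith [Real.quadratic_le_exp_of_nonneg hx.le]
  have h0 : g 0 ≤ g y := hmono Set.self_mem_Ici hy hy
  have h : 6 - 2 * y ≤ Real.exp (-y) * (6 + 4 * y + y ^ 2) := by
    simp only [g, neg_zero, Real.exp_zero] at h0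
    linarith
  rwa [Real.exp_neg, le_inv_mul_iff₀ (Real.exp_pos y)] at h

/-- Bernstein's quadratic upper bound for the exponential on `(-∞, L]`, for `L < 3`. -/
lemma Real.exp_le_one_add_add_sq_div {y L : ℝ} (hyL : y ≤ L) (hL0 : 0 ≤ L) (hL : L < 3) :
    Real.exp y ≤ 1 + y + y ^ 2 / (2 * (1 - L / 3)) := by
  rcases le_total y 0 with hy | hy
  · refine (Real.exp_le_quadratic_of_nonpos hy).trans ?_
    gcongr
    · linarith
    · linarith
  · have hpos : 0 < 6 - 2 * y := by linarith
    have h : Real.exp y ≤ (6 + 4 * y + y ^ 2) / (6 - 2 * y) := by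
      rw [le_div_iff₀ hpos]
      exact Real.exp_mul_six_sub_le hy
    have heq : (6 + 4 * y + y ^ 2) / (6 - 2 * y) = 1 + y + y ^ 2 / (2 * (1 - y / 3)) := by
      have hne : 3 - y ≠ 0 := by linarith
      rw [show 6 - 2 * y = 2 * (3 - y) by ring, show 1 - y / 3 = (3 - y) / 3 by ring]
      field_simp
      ring
    rw [heq] at h
    refine h.trans ?_
    gcongr
    linarith

open ProbabilityTheory in
/-- **Conditional Bernstein bound**: a random variable bounded by `D` in absolute value, with
nonpositive conditional expectation, has its conditional moment generating function controlled by
its conditional variance. -/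
lemma condExp_exp_mul_le_exp_mul_condVar {Ω : Type*} {m' m0 : MeasurableSpace Ω} {μ : Measure Ω}
    [IsFiniteMeasure μ] (hm : m' ≤ m0) {X : Ω → ℝ} (hX : AEStronglyMeasurable X μ) {D l : ℝ}
    (hD : 0 < D) (hbdd : ∀ᵐ ω ∂μ, |X ω| ≤ D) (hneg : μ[X | m'] ≤ᵐ[μ] 0)
    (hl : 0 ≤ l) (hlD : l * D < 3) :
    μ[fun ω => Real.exp (l * X ω) | m'] ≤ᵐ[μ]
      fun ω => Real.exp (l ^ 2 / (2 * (1 - l * D / 3)) * Var[X; μ | m'] ω) := by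
  set ψ : ℝ := l ^ 2 / (2 * (1 - l * D / 3)) with hψ
  have hψ0 : 0 ≤ ψ := div_nonneg (sq_nonneg l) (by linarith)
  have hXL : MemLp X 2 μ := MemLp.of_bound hX D hbdd
  have hXi : Integrable X μ := hXL.integrable one_le_two
  let Z : Ω → ℝ := X - μ[X | m']
  let r : Ω → ℝ := fun ω => D / (D - (μ[X | m']) ω)
  have hZ : Integrable Z μ := hXi.sub integrable_condExp
  have hZ2 : Integrable (Z ^ 2) μ := (hXL.sub (hXL.condExp one_le_two)).integrable_sq
  have hr : StronglyMeasurable[m'] r :=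
    (measurable_const.div (measurable_const.sub
      stronglyMeasurable_condExp.measurable)).stronglyMeasurable
  have hrb : ∀ᵐ ω ∂μ, 0 ≤ r ω ∧ r ω ≤ 1 := by
    filter_upwards [hneg] with ω hω
    have hω : (μ[X | m']) ω ≤ 0 := hω
    exact ⟨div_nonneg hD.le (by linarith), (div_le_one (by linarith)).2 (by linarith)⟩
  have hrZ : Integrable (r * Z) μ := by
    refine hZ.bdd_mul (c := 1) (hr.mono hm).aestronglyMeasurable ?_
    filter_upwards [hrb] with ω hω
    rw [Real.norm_eq_abs, abs_le]
    constructor <;> linarith [hω.1, hω.2]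
  have hexp : Integrable (fun ω => Real.exp (l * X ω)) μ := by
    refine Integrable.of_bound (Real.continuous_exp.comp_aestronglyMeasurable (hX.const_mul l))
      (Real.exp (l * D)) ?_
    filter_upwards [hbdd] with ω hω
    rw [Real.norm_eq_abs, Real.abs_exp]
    gcongr
    exact (le_abs_self _).trans hω
  have hpt : (fun ω => Real.exp (l * X ω)) ≤ᵐ[μ]
      ((fun _ => (1 : ℝ)) + l • (r * Z)) + ψ • Z ^ 2 := by
    filter_upwards [hbdd, hneg, hrb] with ω hω hEω hrω
    have hEω : (μ[X | m']) ω ≤ 0 := hEω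
    have hXD : X ω ≤ D := (le_abs_self _).trans hω
    have hpos : 0 < D - (μ[X | m']) ω := by linarith
    have hZω : Z ω = X ω - (μ[X | m']) ω := rfl
    have hrω' : r ω = D / (D - (μ[X | m']) ω) := rfl
    have hup : r ω * Z ω ≤ D := by
      rw [hrω', hZω, div_mul_eq_mul_div, div_le_iff₀ hpos]
      gcongr
    have hlow : X ω ≤ r ω * Z ω := by
      rw [hrω', hZω, div_mul_eq_mul_div, le_div_iff₀ hpos]
      nlinarith [mul_nonneg (neg_nonneg.2 hEω) (sub_nonneg.2 hXD)]
    have hsq : (r ω * Z ω) ^ 2 ≤ Z ω ^ 2 := by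
      rw [mul_pow]
      exact mul_le_of_le_one_left (sq_nonneg _) (pow_le_one₀ hrω.1 hrω.2)
    calc Real.exp (l * X ω) ≤ Real.exp (l * (r ω * Z ω)) := by gcongr
      _ ≤ 1 + l * (r ω * Z ω) + (l * (r ω * Z ω)) ^ 2 / (2 * (1 - l * D / 3)) :=
          Real.exp_le_one_add_add_sq_div (by gcongr) (by positivity) hlD
      _ = 1 + l * (r ω * Z ω) + ψ * (r ω * Z ω) ^ 2 := by rw [hψ]; ring
      _ ≤ 1 + l * (r ω * Z ω) + ψ * Z ω ^ 2 := by gcongr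
  have h1 : Integrable (fun _ : Ω => (1 : ℝ)) μ := integrable_const 1
  have hcentered : μ[Z | m'] =ᵐ[μ] 0 := by
    filter_upwards [condExp_sub hXi (integrable_condExp (m := m') (μ := μ) (f := X)) m'] with ω h
    rw [h, Pi.sub_apply,
      condExp_of_stronglyMeasurable hm stronglyMeasurable_condExp integrable_condExp]
    simp
  filter_upwards [condExp_mono (m := m') hexp
      ((h1.add (hrZ.smul l)).add (hZ2.smul ψ)) hpt,
    condExp_add (h1.add (hrZ.smul l)) (hZ2.smul ψ) m', condExp_add h1 (hrZ.smul l) m',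
    condExp_smul l (r * Z) m', condExp_smul ψ (Z ^ 2) m',
    condExp_mul_of_stronglyMeasurable_left hr hrZ hZ, hcentered]
    with ω hmono hadd hadd' hl' hψ' hmul hZ0
  rw [hadd, Pi.add_apply, hadd', Pi.add_apply, hl', hψ', Pi.smul_apply, Pi.smul_apply, hmul,
    Pi.mul_apply, hZ0, condExp_const hm] at hmono
  refine hmono.trans ?_
  have := Real.add_one_le_exp (ψ * Var[X; μ | m'] ω)
  simp only [Pi.zero_apply, mul_zero, smul_eq_mul, add_zero]
  change 1 + ψ * Var[X; μ | m'] ω ≤ _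
  linarith

open ProbabilityTheory in
/-- The exponential process of Freedman's inequality has mean at most one. -/
lemma integral_exp_sub_condVar_le_one {Ω : Type*} {m0 : MeasurableSpace Ω} {μ : Measure Ω}
    [IsProbabilityMeasure μ] {m : ℕ} {ℱ : ℕ → MeasurableSpace Ω} (hmono : Monotone ℱ)
    (hle : ∀ i, ℱ i ≤ m0) {Y : ℕ → Ω → ℝ}
    (hadapt : ∀ i ≤ m, StronglyMeasurable[ℱ i] (Y i))
    (hdiff : ∀ i < m, μ[Y (i + 1) - Y i | ℱ i] ≤ᵐ[μ] 0)
    {D l : ℝ} (hD : 0 < D) (hbdd : ∀ i < m, ∀ᵐ ω ∂μ, |Y (i + 1) ω - Y i ω| ≤ D)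
    (hl : 0 ≤ l) (hlD : l * D < 3) :
    let M : ℕ → Ω → ℝ := fun k ω => Real.exp (l * (Y k ω - Y 0 ω) - l ^ 2 / (2 * (1 - l * D / 3)) *
      ∑ j ∈ Finset.range k, Var[Y (j + 1) - Y j; μ | ℱ j] ω)
    ∀ k ≤ m, Integrable (M k) μ ∧ ∫ ω, M k ω ∂μ ≤ 1 := by
  intro M
  set ψ : ℝ := l ^ 2 / (2 * (1 - l * D / 3)) with hψ
  have hψ0 : 0 ≤ ψ := div_nonneg (sq_nonneg l) (by linarith)
  have hV0 : ∀ j, ∀ᵐ ω ∂μ, 0 ≤ Var[Y (j + 1) - Y j; μ | ℱ j] ω := fun j =>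
    condExp_nonneg (ae_of_all _ fun ω => sq_nonneg _)
  have hVm : ∀ j k, j ≤ k → StronglyMeasurable[ℱ k] Var[Y (j + 1) - Y j; μ | ℱ j] := fun j k hjk =>
    stronglyMeasurable_condExp.mono (hmono hjk)
  have hWm : ∀ k i, k ≤ i + 1 → StronglyMeasurable[ℱ i]
      (fun ω => ∑ j ∈ Finset.range k, Var[Y (j + 1) - Y j; μ | ℱ j] ω) := fun k i hk =>
    Finset.stronglyMeasurable_fun_sum _ fun j hj =>
      hVm j i (by have := Finset.mem_range.1 hj; omega)
  have hYm : ∀ k ≤ m, StronglyMeasurable[ℱ k] (fun ω => Y k ω - Y 0 ω) := fun k hk =>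
    (hadapt k hk).sub ((hadapt 0 (Nat.zero_le m)).mono (hmono (Nat.zero_le k)))
  have hMm : ∀ k ≤ m, StronglyMeasurable[ℱ k] (M k) := fun k hk =>
    Real.continuous_exp.comp_stronglyMeasurable
      (((hYm k hk).const_mul l).sub ((hWm k k (Nat.le_succ k)).const_mul ψ))
  have hW0 : ∀ᵐ ω ∂μ, ∀ k, 0 ≤ ∑ j ∈ Finset.range k, Var[Y (j + 1) - Y j; μ | ℱ j] ω := by
    filter_upwards [ae_all_iff.2 hV0] with ω hω k using Finset.sum_nonneg fun j _ => hω j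
  have hYb : ∀ k ≤ m, ∀ᵐ ω ∂μ, Y k ω - Y 0 ω ≤ k * D := by
    intro k
    induction k with
    | zero => simp
    | succ k ih =>
      intro hk
      filter_upwards [ih (by omega), hbdd k hk] with ω h1 h2
      push_cast
      linarith [le_abs_self (Y (k + 1) ω - Y k ω)]
  have hbound : ∀ k ≤ m, ∀ i, ∀ᵐ ω ∂μ, Real.exp (l * (Y k ω - Y 0 ω) - ψ *
      ∑ j ∈ Finset.range i, Var[Y (j + 1) - Y j; μ | ℱ j] ω) ≤ Real.exp (l * (k * D)) := by
    intro k hk i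
    filter_upwards [hYb k hk, hW0] with ω h1 h2
    have := mul_le_mul_of_nonneg_left h1 hl
    have := mul_nonneg hψ0 (h2 i)
    gcongr
    linarith
  have hMi : ∀ k ≤ m, Integrable (M k) μ := fun k hk => by
    refine Integrable.of_bound ((hMm k hk).mono (hle k)).aestronglyMeasurable
      (Real.exp (l * (k * D))) ?_
    filter_upwards [hbound k hk k] with ω hω
    rwa [Real.norm_eq_abs, Real.abs_exp]
  intro k hk
  refine ⟨hMi k hk, ?_⟩
  induction k with
  | zero => simp [M]
  | succ k ih =>
    refine le_trans ?_ (ih (by omega))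
    have hkm : k ≤ m := by omega
    let G : Ω → ℝ := fun ω => Real.exp (l * (Y k ω - Y 0 ω) - ψ *
      ∑ j ∈ Finset.range (k + 1), Var[Y (j + 1) - Y j; μ | ℱ j] ω)
    let E : Ω → ℝ := fun ω => Real.exp (l * (Y (k + 1) - Y k) ω)
    have hGm : StronglyMeasurable[ℱ k] G := Real.continuous_exp.comp_stronglyMeasurable
      (((hYm k hkm).const_mul l).sub ((hWm (k + 1) k le_rfl).const_mul ψ))
    have hXm : StronglyMeasurable (Y (k + 1) - Y k) :=
      ((hadapt (k + 1) hk).mono (hle _)).sub ((hadapt k hkm).mono (hle _))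
    have hEi : Integrable E μ := by
      refine Integrable.of_bound (Real.continuous_exp.comp_stronglyMeasurable
        (hXm.const_mul l)).aestronglyMeasurable (Real.exp (l * D)) ?_
      filter_upwards [hbdd k hk] with ω hω
      rw [Real.norm_eq_abs, Real.abs_exp]
      gcongr
      exact (le_abs_self _).trans hω
    have hMG : M (k + 1) = G * E := by
      ext ω
      simp only [M, G, E, Pi.mul_apply, ← Real.exp_add, Pi.sub_apply]
      congr 1
      ring
    have hGE : Integrable (G * E) μ := hMG ▸ hMi (k + 1) hk
    calc ∫ ω, M (k + 1) ω ∂μ = ∫ ω, (μ[G * E | ℱ k]) ω ∂μ := by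
          rw [integral_condExp (hle k), hMG]
      _ ≤ ∫ ω, M k ω ∂μ := by
        refine integral_mono_ae integrable_condExp (hMi k hkm) ?_
        filter_upwards [condExp_mul_of_stronglyMeasurable_left hGm hGE hEi,
          condExp_exp_mul_le_exp_mul_condVar (hle k) hXm.aestronglyMeasurable hD (hbdd k hk)
            (hdiff k hk) hl hlD] with ω h1 h2
        rw [h1, Pi.mul_apply]
        calc G ω * (μ[E | ℱ k]) ω
            ≤ G ω * Real.exp (ψ * Var[Y (k + 1) - Y k; μ | ℱ k] ω) :=
              mul_le_mul_of_nonneg_left h2 (Real.exp_pos _).le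
          _ = M k ω := by
              simp only [M, G, ← Real.exp_add, Finset.sum_range_succ]
              congr 1
              ring

/-- **Freedman's inequality** (simplified form). If `(Y_i)_{i=0}^m` is a
supermartingale with respect to the filtration `ℱ`, with differences bounded
by `D` and cumulative conditional variance `W_m ≤ b` almost surely, then
`P(Y_m ≥ Y_0 + δ) ≤ exp(−δ²/(2(Dδ/3 + b)))`. -/
theorem stmt_5 {Ω : Type*} {m0 : MeasurableSpace Ω} (μ : Measure Ω)
    [IsProbabilityMeasure μ]
    (m : ℕ) (ℱ : ℕ → MeasurableSpace Ω) (hmono : Monotone ℱ) (hle : ∀ i, ℱ i ≤ m0)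
    (Y : ℕ → Ω → ℝ)
    (hadapt : ∀ i ≤ m, StronglyMeasurable[ℱ i] (Y i))
    (hint : ∀ i ≤ m, Integrable (Y i) μ)
    (hsuper : ∀ i, 1 ≤ i → i ≤ m → μ[Y i | ℱ (i - 1)] ≤ᵐ[μ] Y (i - 1))
    (D : ℝ) (hD : 0 < D)
    (hbdd : ∀ i, 1 ≤ i → i ≤ m → ∀ᵐ ω ∂μ, |Y i ω - Y (i - 1) ω| ≤ D)
    (b δ : ℝ) (hδ : 0 < δ)
    (hvar : ∀ᵐ ω ∂μ,
      ∑ j ∈ Finset.Icc 1 m,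
        (μ[fun ω' => (Y j ω' - Y (j - 1) ω' -
            (μ[fun ω'' => Y j ω'' - Y (j - 1) ω'' | ℱ (j - 1)]) ω') ^ 2 | ℱ (j - 1)]) ω
        ≤ b) :
    (μ {ω | Y 0 ω + δ ≤ Y m ω}).toReal ≤
      Real.exp (-δ ^ 2 / (2 * (D * δ / 3 + b))) := by
  have hvar' : ∀ᵐ ω ∂μ,
      ∑ j ∈ Finset.range m, ProbabilityTheory.condVar (ℱ j) (Y (j + 1) - Y j) μ ω ≤ b := by
    filter_upwards [hvar] with ω hω
    rw [← Finset.Ico_add_one_right_eq_Icc, Finset.sum_Ico_eq_sum_range] at hω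
    simp only [Nat.add_sub_cancel, Nat.add_comm 1] at hω
    exact hω
  have hb0 : 0 ≤ b := by
    have hV : ∀ᵐ ω ∂μ, ∀ j, 0 ≤ ProbabilityTheory.condVar (ℱ j) (Y (j + 1) - Y j) μ ω :=
      ae_all_iff.2 fun j => condExp_nonneg (ae_of_all _ fun ω => sq_nonneg _)
    obtain ⟨ω, h1, h2⟩ := (hvar'.and hV).exists
    exact (Finset.sum_nonneg fun j _ => h2 j).trans h1
  have hdiff : ∀ i < m, μ[Y (i + 1) - Y i | ℱ i] ≤ᵐ[μ] 0 := fun i hi => by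
    filter_upwards [condExp_sub (hint (i + 1) hi) (hint i hi.le) (ℱ i),
      hsuper (i + 1) (by omega) hi] with ω h1 h2
    rw [h1, Pi.sub_apply, condExp_of_stronglyMeasurable (hle i) (hadapt i hi.le) (hint i hi.le)]
    exact sub_nonpos.2 h2
  have key : ∀ c, b < c → (μ {ω | Y 0 ω + δ ≤ Y m ω}).toReal ≤
      Real.exp (-δ ^ 2 / (2 * (D * δ / 3 + c))) := by
    intro c hc
    have hc0 : 0 < c := hb0.trans_lt hc
    have hs : 0 < D * δ / 3 + c := by positivity
    set l : ℝ := δ / (D * δ / 3 + c) with hl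
    have hl0 : 0 ≤ l := by positivity
    have hlD : l * D < 3 := by
      rw [hl, div_mul_eq_mul_div, div_lt_iff₀ hs]
      linarith
    obtain ⟨hMi, hM1⟩ := integral_exp_sub_condVar_le_one hmono hle hadapt hdiff hD
      (fun i hi => hbdd (i + 1) (by omega) hi) hl0 hlD m le_rfl
    have hψ0 : 0 ≤ l ^ 2 / (2 * (1 - l * D / 3)) := div_nonneg (sq_nonneg l) (by linarith)
    have hexp : l * δ - l ^ 2 / (2 * (1 - l * D / 3)) * c =
        δ ^ 2 / (2 * (D * δ / 3 + c)) := by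
      have h1 : 1 - l * D / 3 = c / (D * δ / 3 + c) := by
        rw [hl]
        field_simp
        ring
      rw [h1, hl]
      field_simp
      ring
    have hmarkov := mul_meas_ge_le_integral_of_nonneg
      (ae_of_all _ fun ω => (Real.exp_pos _).le) hMi (Real.exp (δ ^ 2 / (2 * (D * δ / 3 + c))))
    have hsub : (μ {ω | Y 0 ω + δ ≤ Y m ω}).toReal ≤ μ.real {ω |
        Real.exp (δ ^ 2 / (2 * (D * δ / 3 + c))) ≤ Real.exp (l * (Y m ω - Y 0 ω) -
          l ^ 2 / (2 * (1 - l * D / 3)) *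
          ∑ j ∈ Finset.range m, ProbabilityTheory.condVar (ℱ j) (Y (j + 1) - Y j) μ ω)} := by
      refine ENNReal.toReal_mono (measure_ne_top _ _) (measure_mono_ae ?_)
      filter_upwards [hvar'] with ω hω
      intro (hY : Y 0 ω + δ ≤ Y m ω)
      change Real.exp _ ≤ Real.exp _
      rw [← hexp]
      have : δ ≤ Y m ω - Y 0 ω := by linarith
      gcongr
      exact hω.trans hc.le
    rw [neg_div, Real.exp_neg, ← one_div, le_div_iff₀' (Real.exp_pos _)]
    exact (mul_le_mul_of_nonneg_left hsub (Real.exp_pos _).le).trans (hmarkov.trans hM1)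
  have hcont : ContinuousAt (fun c => Real.exp (-δ ^ 2 / (2 * (D * δ / 3 + c)))) b := by
    have : 2 * (D * δ / 3 + b) ≠ 0 := by positivity
    fun_prop (disch := assumption)
  exact ge_of_tendsto (hcont.tendsto.mono_left nhdsWithin_le_nhds)
    (Filter.eventually_of_mem self_mem_nhdsWithin key : ∀ᶠ c in nhdsWithin b (Set.Ioi b), _)
end

section
/- Let α, a > 0. There exists Δ₀ = Δ₀(α, a) such that for all Δ ≥ Δ₀ the following holds. Let (Ω, ℱ, P) be a probability space with a filtration ℱ₀ ⊆ ℱ₁ ⊆ … ⊆ ℱ_t, let (D_i)_{i=1}^{t} be a martingale difference sequence with respect to this filtration with |D_i| ≤ 1 almost surely for all i, and let (β_i)_{i=1}^{t} be random variables such that each β_i is ℱ_{i−1}-measurable, and almost surely ∑_{i=1}^{t} |β_i| ≤ Δ and |β_i| ≤ a for every i. Then P(∑_{i=1}^{t} β_i D_i ≥ α·Δ) ≤ exp(−α⁴·Δ / (128·a)). -/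
open MeasureTheory

theorem Real.exp_mul_sub_half_sq_le {d : ℝ} (hd : |d| ≤ 1) (c : ℝ) :
    Real.exp (c * d - c ^ 2 / 2) ≤ 1 + Real.exp (-(c ^ 2 / 2)) * Real.sinh c * d := by
  have h := (Real.exp_mul_le_cosh_add_mul_sinh hd c).trans
    (add_le_add_left (Real.cosh_le_exp_half_sq c) _)
  have he : Real.exp (-(c ^ 2 / 2)) * Real.exp (c ^ 2 / 2) = 1 := by
    rw [← Real.exp_add]; simp
  calc Real.exp (c * d - c ^ 2 / 2)
      = Real.exp (-(c ^ 2 / 2)) * Real.exp (d * c) := by rw [← Real.exp_add]; ring_nf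
    _ ≤ Real.exp (-(c ^ 2 / 2)) * (Real.exp (c ^ 2 / 2) + d * Real.sinh c) := by gcongr
    _ = 1 + Real.exp (-(c ^ 2 / 2)) * Real.sinh c * d := by rw [mul_add, he]; ring

theorem integral_mul_eq_zero_of_condExp_eq_zero {Ω : Type*} {m m0 : MeasurableSpace Ω}
    {μ : Measure Ω} [IsFiniteMeasure μ] (hm : m ≤ m0) {f D : Ω → ℝ} {B : ℝ}
    (hf : StronglyMeasurable[m] f) (hfB : ∀ᵐ ω ∂μ, ‖f ω‖ ≤ B)
    (hD : Integrable D μ) (hD0 : μ[D | m] =ᵐ[μ] 0) :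
    ∫ ω, f ω * D ω ∂μ = 0 := by
  have hint : Integrable (f * D) μ := hD.bdd_mul (hf.mono hm).aestronglyMeasurable hfB
  calc ∫ ω, f ω * D ω ∂μ = ∫ ω, (μ[f * D | m]) ω ∂μ := (integral_condExp hm).symm
    _ = ∫ _, (0 : ℝ) ∂μ := by
      refine integral_congr_ae ?_
      filter_upwards [condExp_mul_of_stronglyMeasurable_left hf hint hD, hD0] with ω h1 h2
      simp [h1, h2]
    _ = 0 := by simp

theorem integral_mul_exp_mul_sub_half_sq_le {Ω : Type*} {m m0 : MeasurableSpace Ω}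
    {μ : Measure Ω} [IsFiniteMeasure μ] (hm : m ≤ m0) {Z c D : Ω → ℝ} {B C : ℝ}
    (hZ : StronglyMeasurable[m] Z) (hZ0 : ∀ ω, 0 ≤ Z ω) (hZB : ∀ᵐ ω ∂μ, Z ω ≤ B)
    (hc : StronglyMeasurable[m] c) (hcC : ∀ᵐ ω ∂μ, |c ω| ≤ C)
    (hD : Integrable D μ) (hD0 : μ[D | m] =ᵐ[μ] 0) (hD1 : ∀ᵐ ω ∂μ, |D ω| ≤ 1) :
    ∫ ω, Z ω * Real.exp (c ω * D ω - c ω ^ 2 / 2) ∂μ ≤ ∫ ω, Z ω ∂μ := by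
  set f : Ω → ℝ := fun ω => Z ω * (Real.exp (-(c ω ^ 2 / 2)) * Real.sinh (c ω)) with hf_def
  have hf : StronglyMeasurable[m] f := by
    refine hZ.mul ?_
    exact (show Continuous fun x : ℝ => Real.exp (-(x ^ 2 / 2)) * Real.sinh x by
      fun_prop).comp_stronglyMeasurable hc
  have hfB : ∀ᵐ ω ∂μ, ‖f ω‖ ≤ B * (1 * Real.sinh C) := by
    filter_upwards [hZB, hcC] with ω h1 h2
    rw [hf_def, Real.norm_eq_abs, abs_mul, abs_mul, abs_of_nonneg (hZ0 ω), Real.abs_exp,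
      Real.abs_sinh]
    have hs : 0 ≤ Real.sinh |c ω| := Real.sinh_nonneg_iff.2 (abs_nonneg _)
    have : 0 ≤ B := (hZ0 ω).trans h1
    gcongr
    · exact Real.exp_le_one_iff.2 (by nlinarith [sq_nonneg (c ω)])
    · exact Real.sinh_le_sinh.2 h2
  have hZint : Integrable Z μ := by
    refine Integrable.of_bound (hZ.mono hm).aestronglyMeasurable B ?_
    filter_upwards [hZB] with ω h1
    rwa [Real.norm_eq_abs, abs_of_nonneg (hZ0 ω)]
  have hfD : Integrable (fun ω => f ω * D ω) μ :=
    hD.bdd_mul (hf.mono hm).aestronglyMeasurable hfB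
  calc ∫ ω, Z ω * Real.exp (c ω * D ω - c ω ^ 2 / 2) ∂μ
      ≤ ∫ ω, (Z ω + f ω * D ω) ∂μ := by
        refine integral_mono_of_nonneg ?_ (hZint.add hfD) ?_
        · exact .of_forall fun ω => mul_nonneg (hZ0 ω) (Real.exp_nonneg _)
        · filter_upwards [hD1] with ω h1
          have := mul_le_mul_of_nonneg_left (Real.exp_mul_sub_half_sq_le h1 (c ω)) (hZ0 ω)
          simp only [hf_def]
          linarith
    _ = ∫ ω, Z ω ∂μ := by
      rw [integral_add hZint hfD, integral_mul_eq_zero_of_condExp_eq_zero hm hf hfB hD hD0,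
        add_zero]

/-- The logarithm of the exponential supermartingale of the transform of `D` by `c`. -/
noncomputable def compensatedSum {Ω : Type*} (c D : ℕ → Ω → ℝ) (k : ℕ) (ω : Ω) : ℝ :=
  ∑ i ∈ Finset.Icc 1 k, (c i ω * D i ω - c i ω ^ 2 / 2)

section

variable {Ω : Type*} {m0 : MeasurableSpace Ω} {μ : Measure Ω} {ℱ : ℕ → MeasurableSpace Ω}
  {c D : ℕ → Ω → ℝ} {C : ℝ} {k : ℕ}

theorem stronglyMeasurable_compensatedSum (hℱ : Monotone ℱ)
    (hD : ∀ i, 1 ≤ i → i ≤ k → StronglyMeasurable[ℱ i] (D i))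
    (hc : ∀ i, 1 ≤ i → i ≤ k → StronglyMeasurable[ℱ (i - 1)] (c i)) :
    StronglyMeasurable[ℱ k] (compensatedSum c D k) := by
  refine Finset.stronglyMeasurable_fun_sum _ fun i hi => ?_
  obtain ⟨h1, h2⟩ := Finset.mem_Icc.1 hi
  have hci : StronglyMeasurable[ℱ k] (c i) := (hc i h1 h2).mono (hℱ (by omega))
  exact (hci.mul ((hD i h1 h2).mono (hℱ h2))).sub
    ((show Continuous fun x : ℝ => x ^ 2 / 2 by fun_prop).comp_stronglyMeasurable hci)

theorem exp_compensatedSum_le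
    (hD1 : ∀ i, 1 ≤ i → i ≤ k → ∀ᵐ ω ∂μ, |D i ω| ≤ 1)
    (hcC : ∀ i, 1 ≤ i → i ≤ k → ∀ᵐ ω ∂μ, |c i ω| ≤ C) :
    ∀ᵐ ω ∂μ, Real.exp (compensatedSum c D k ω) ≤ Real.exp (k * C) := by
  have h : ∀ᵐ ω ∂μ, ∀ i, 1 ≤ i → i ≤ k → |D i ω| ≤ 1 ∧ |c i ω| ≤ C := by
    simp only [ae_all_iff]
    exact fun i h1 h2 => (hD1 i h1 h2).and (hcC i h1 h2)
  filter_upwards [h] with ω hω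
  refine Real.exp_le_exp.2 ?_
  calc compensatedSum c D k ω ≤ ∑ i ∈ Finset.Icc 1 k, C := by
        refine Finset.sum_le_sum fun i hi => ?_
        obtain ⟨h1, h2⟩ := Finset.mem_Icc.1 hi
        obtain ⟨h3, h4⟩ := hω i h1 h2
        have h5 : |c i ω * D i ω| ≤ |c i ω| := by
          rw [abs_mul]; exact mul_le_of_le_one_right (abs_nonneg _) h3
        nlinarith [le_abs_self (c i ω * D i ω), sq_nonneg (c i ω)]
    _ = k * C := by simp

theorem integrable_exp_compensatedSum [IsFiniteMeasure μ] (hℱ : Monotone ℱ) (hle : ∀ i, ℱ i ≤ m0)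
    (hD : ∀ i, 1 ≤ i → i ≤ k → StronglyMeasurable[ℱ i] (D i))
    (hD1 : ∀ i, 1 ≤ i → i ≤ k → ∀ᵐ ω ∂μ, |D i ω| ≤ 1)
    (hc : ∀ i, 1 ≤ i → i ≤ k → StronglyMeasurable[ℱ (i - 1)] (c i))
    (hcC : ∀ i, 1 ≤ i → i ≤ k → ∀ᵐ ω ∂μ, |c i ω| ≤ C) :
    Integrable (fun ω => Real.exp (compensatedSum c D k ω)) μ := by
  refine Integrable.of_bound (Real.continuous_exp.comp_stronglyMeasurable
    ((stronglyMeasurable_compensatedSum hℱ hD hc).mono (hle k))).aestronglyMeasurable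
    (Real.exp (k * C)) ?_
  filter_upwards [exp_compensatedSum_le hD1 hcC] with ω hω
  rwa [Real.norm_eq_abs, Real.abs_exp]

theorem integral_exp_compensatedSum_le_one [IsProbabilityMeasure μ]
    (hℱ : Monotone ℱ) (hle : ∀ i, ℱ i ≤ m0)
    (hD : ∀ i, 1 ≤ i → i ≤ k → StronglyMeasurable[ℱ i] (D i))
    (hDint : ∀ i, 1 ≤ i → i ≤ k → Integrable (D i) μ)
    (hD0 : ∀ i, 1 ≤ i → i ≤ k → μ[D i | ℱ (i - 1)] =ᵐ[μ] 0)
    (hD1 : ∀ i, 1 ≤ i → i ≤ k → ∀ᵐ ω ∂μ, |D i ω| ≤ 1)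
    (hc : ∀ i, 1 ≤ i → i ≤ k → StronglyMeasurable[ℱ (i - 1)] (c i))
    (hcC : ∀ i, 1 ≤ i → i ≤ k → ∀ᵐ ω ∂μ, |c i ω| ≤ C) :
    ∫ ω, Real.exp (compensatedSum c D k ω) ∂μ ≤ 1 := by
  induction k with
  | zero => simp [compensatedSum]
  | succ n ih =>
    have hD' : ∀ i, 1 ≤ i → i ≤ n → StronglyMeasurable[ℱ i] (D i) :=
      fun i h1 h2 => hD i h1 (by omega)
    have hD1' : ∀ i, 1 ≤ i → i ≤ n → ∀ᵐ ω ∂μ, |D i ω| ≤ 1 :=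
      fun i h1 h2 => hD1 i h1 (by omega)
    have hc' : ∀ i, 1 ≤ i → i ≤ n → StronglyMeasurable[ℱ (i - 1)] (c i) :=
      fun i h1 h2 => hc i h1 (by omega)
    have hcC' : ∀ i, 1 ≤ i → i ≤ n → ∀ᵐ ω ∂μ, |c i ω| ≤ C :=
      fun i h1 h2 => hcC i h1 (by omega)
    have hn : 1 ≤ n + 1 := by omega
    calc ∫ ω, Real.exp (compensatedSum c D (n + 1) ω) ∂μ
        = ∫ ω, Real.exp (compensatedSum c D n ω) *
            Real.exp (c (n + 1) ω * D (n + 1) ω - c (n + 1) ω ^ 2 / 2) ∂μ := by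
          simp only [compensatedSum, Finset.sum_Icc_succ_top hn, Real.exp_add]
      _ ≤ ∫ ω, Real.exp (compensatedSum c D n ω) ∂μ :=
          integral_mul_exp_mul_sub_half_sq_le (hle n)
            (Real.continuous_exp.comp_stronglyMeasurable
              (stronglyMeasurable_compensatedSum hℱ hD' hc'))
            (fun ω => Real.exp_nonneg _) (exp_compensatedSum_le hD1' hcC')
            (hc (n + 1) hn le_rfl) (hcC (n + 1) hn le_rfl) (hDint (n + 1) hn le_rfl)
            (hD0 (n + 1) hn le_rfl) (hD1 (n + 1) hn le_rfl)
      _ ≤ 1 := ih hD' (fun i h1 h2 => hDint i h1 (by omega)) (fun i h1 h2 => hD0 i h1 (by omega))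
          hD1' hc' hcC'

/-- Azuma–Hoeffding inequality for a martingale transform with bounded quadratic variation. -/
theorem measureReal_sum_mul_ge_le_of_sum_sq_le [IsProbabilityMeasure μ]
    (hℱ : Monotone ℱ) (hle : ∀ i, ℱ i ≤ m0)
    (hD : ∀ i, 1 ≤ i → i ≤ k → StronglyMeasurable[ℱ i] (D i))
    (hDint : ∀ i, 1 ≤ i → i ≤ k → Integrable (D i) μ)
    (hD0 : ∀ i, 1 ≤ i → i ≤ k → μ[D i | ℱ (i - 1)] =ᵐ[μ] 0)
    (hD1 : ∀ i, 1 ≤ i → i ≤ k → ∀ᵐ ω ∂μ, |D i ω| ≤ 1)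
    (hc : ∀ i, 1 ≤ i → i ≤ k → StronglyMeasurable[ℱ (i - 1)] (c i))
    (hcC : ∀ i, 1 ≤ i → i ≤ k → ∀ᵐ ω ∂μ, |c i ω| ≤ C)
    {V : ℝ} (hV : 0 < V) (hcV : ∀ᵐ ω ∂μ, ∑ i ∈ Finset.Icc 1 k, c i ω ^ 2 ≤ V)
    {x : ℝ} (hx : 0 ≤ x) :
    μ.real {ω | x ≤ ∑ i ∈ Finset.Icc 1 k, c i ω * D i ω} ≤ Real.exp (-(x ^ 2 / (2 * V))) := by
  set l : ℝ := x / V with hl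
  have hl0 : 0 ≤ l := by positivity
  set b : ℕ → Ω → ℝ := fun i ω => l * c i ω with hb
  have hbm : ∀ i, 1 ≤ i → i ≤ k → StronglyMeasurable[ℱ (i - 1)] (b i) :=
    fun i h1 h2 => (hc i h1 h2).const_mul l
  have hbC : ∀ i, 1 ≤ i → i ≤ k → ∀ᵐ ω ∂μ, |b i ω| ≤ l * C := by
    intro i h1 h2
    filter_upwards [hcC i h1 h2] with ω hω
    rw [hb, abs_mul, abs_of_nonneg hl0]
    gcongr
  have hlog : l * x - l ^ 2 * V / 2 = x ^ 2 / (2 * V) := by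
    rw [hl]; field_simp; ring
  have hmarkov := mul_meas_ge_le_integral_of_nonneg
    (.of_forall fun ω => Real.exp_nonneg (compensatedSum b D k ω))
    (integrable_exp_compensatedSum hℱ hle hD hD1 hbm hbC) (Real.exp (x ^ 2 / (2 * V)))
  have hone := integral_exp_compensatedSum_le_one hℱ hle hD hDint hD0 hD1 hbm hbC
  have hsub : μ.real {ω | x ≤ ∑ i ∈ Finset.Icc 1 k, c i ω * D i ω} ≤
      μ.real {ω | Real.exp (x ^ 2 / (2 * V)) ≤ Real.exp (compensatedSum b D k ω)} := by
    refine ENNReal.toReal_mono (measure_ne_top _ _) (measure_mono_ae ?_)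
    filter_upwards [hcV] with ω hω hxω
    have hxω' : x ≤ ∑ i ∈ Finset.Icc 1 k, c i ω * D i ω := hxω
    have hsum : compensatedSum b D k ω = l * ∑ i ∈ Finset.Icc 1 k, c i ω * D i ω -
        l ^ 2 / 2 * ∑ i ∈ Finset.Icc 1 k, c i ω ^ 2 := by
      rw [compensatedSum, Finset.mul_sum, Finset.mul_sum, ← Finset.sum_sub_distrib]
      exact Finset.sum_congr rfl fun i _ => by simp only [hb]; ring
    refine Real.exp_le_exp.2 ?_
    rw [← hlog, hsum]
    nlinarith [mul_le_mul_of_nonneg_left hxω' hl0, mul_le_mul_of_nonneg_left hω (sq_nonneg l)]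
  rw [Real.exp_neg, inv_eq_one_div, le_div_iff₀' (Real.exp_pos _)]
  exact (mul_le_mul_of_nonneg_left hsub (Real.exp_nonneg _)).trans (hmarkov.trans hone)

end

/-- Concentration for derived martingale sums (single coefficient sequence):
if `(D_i)` is a martingale difference sequence with `|D_i| ≤ 1`, and `(β_i)`
are predictable coefficients with `∑|β_i| ≤ Δ` and `|β_i| ≤ a` a.s., then for
`Δ` sufficiently large, `P(∑ β_i D_i ≥ αΔ) ≤ exp(−α⁴Δ/(128a))`. -/
theorem stmt_6 (α a : ℝ) (hα : 0 < α) (ha : 0 < a) :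
    ∃ Δ₀ : ℝ, ∀ Δ : ℝ, Δ₀ ≤ Δ →
      ∀ (Ω : Type) (m0 : MeasurableSpace Ω) (μ : Measure Ω),
        IsProbabilityMeasure μ →
      ∀ (t : ℕ) (ℱ : ℕ → MeasurableSpace Ω), Monotone ℱ → (∀ i, ℱ i ≤ m0) →
      ∀ D : ℕ → Ω → ℝ,
        (∀ i, 1 ≤ i → i ≤ t → StronglyMeasurable[ℱ i] (D i)) →
        (∀ i, 1 ≤ i → i ≤ t → Integrable (D i) μ) →
        (∀ i, 1 ≤ i → i ≤ t → μ[D i | ℱ (i - 1)] =ᵐ[μ] 0) →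
        (∀ i, 1 ≤ i → i ≤ t → ∀ᵐ ω ∂μ, |D i ω| ≤ 1) →
      ∀ β : ℕ → Ω → ℝ,
        (∀ i, 1 ≤ i → i ≤ t → StronglyMeasurable[ℱ (i - 1)] (β i)) →
        (∀ᵐ ω ∂μ, (∑ i ∈ Finset.Icc 1 t, |β i ω|) ≤ Δ ∧
          ∀ i, 1 ≤ i → i ≤ t → |β i ω| ≤ a) →
      (μ {ω | α * Δ ≤ ∑ i ∈ Finset.Icc 1 t, β i ω * D i ω}).toReal ≤
        Real.exp (-(α ^ 4 * Δ) / (128 * a)) := by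
  refine ⟨1, fun Δ hΔ Ω m0 μ _ t ℱ hℱ hle D hD hDint hD0 hD1 β hβ hβΔ => ?_⟩
  have hΔ0 : 0 < Δ := by linarith
  rcases le_or_gt α 1 with hα1 | hα1
  · have hV : ∀ᵐ ω ∂μ, ∑ i ∈ Finset.Icc 1 t, β i ω ^ 2 ≤ a * Δ := by
      filter_upwards [hβΔ] with ω ⟨h1, h2⟩
      calc ∑ i ∈ Finset.Icc 1 t, β i ω ^ 2 ≤ ∑ i ∈ Finset.Icc 1 t, a * |β i ω| := by
            refine Finset.sum_le_sum fun i hi => ?_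
            rw [← sq_abs, sq]
            exact mul_le_mul_of_nonneg_right
              (h2 i (Finset.mem_Icc.1 hi).1 (Finset.mem_Icc.1 hi).2) (abs_nonneg _)
        _ = a * ∑ i ∈ Finset.Icc 1 t, |β i ω| := (Finset.mul_sum _ _ _).symm
        _ ≤ a * Δ := by gcongr
    refine (measureReal_sum_mul_ge_le_of_sum_sq_le hℱ hle hD hDint hD0 hD1 hβ
      (fun i h1 h2 => hβΔ.mono fun ω hω => hω.2 i h1 h2) (mul_pos ha hΔ0) hV
      (mul_nonneg hα.le hΔ0.le)).trans (Real.exp_le_exp.2 ?_)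
    rw [neg_div, neg_le_neg_iff,
      show (α * Δ) ^ 2 / (2 * (a * Δ)) = 64 * α ^ 2 * Δ / (128 * a) by field_simp; ring]
    have hα2 : α ^ 2 ≤ 1 := pow_le_one₀ hα.le hα1
    gcongr
    nlinarith [sq_nonneg α]
  · have hnull : μ {ω | α * Δ ≤ ∑ i ∈ Finset.Icc 1 t, β i ω * D i ω} = 0 := by
      have hD1' : ∀ᵐ ω ∂μ, ∀ i, 1 ≤ i → i ≤ t → |D i ω| ≤ 1 := by
        simpa only [ae_all_iff] using hD1
      refine measure_eq_zero_iff_ae_notMem.2 ?_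
      filter_upwards [hβΔ, hD1'] with ω ⟨h1, _⟩ h2
      have hsum : ∑ i ∈ Finset.Icc 1 t, β i ω * D i ω ≤ ∑ i ∈ Finset.Icc 1 t, |β i ω| := by
        refine Finset.sum_le_sum fun i hi => (le_abs_self _).trans ?_
        rw [abs_mul]
        exact mul_le_of_le_one_right (abs_nonneg _)
          (h2 i (Finset.mem_Icc.1 hi).1 (Finset.mem_Icc.1 hi).2)
      rw [not_le]
      nlinarith
    rw [hnull, ENNReal.toReal_zero]
    exact Real.exp_nonneg _
end

section
/- Let K > 0 be a real number and, for a nonempty finite set A and a finite set T, define δ(A, T) = |A ∩ T|/|A| − |T|/K. Let A, B, S be finite sets with A and B nonempty and A ∩ B nonempty. Then | |A ∩ B ∩ S|/|A ∩ B| − |B ∩ S|/|B| | ≤ (|A| / |A ∩ B|) · ( |δ(A, B ∩ S)| + |δ(A, B)| ). -/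
/-- With `δ(A,T) = |A∩T|/|A| − |T|/K`: for finite sets `A, B, S` with `A`, `B`,
and `A ∩ B` nonempty,
`| |A∩B∩S|/|A∩B| − |B∩S|/|B| | ≤ (|A|/|A∩B|)·(|δ(A, B∩S)| + |δ(A,B)|)`. -/
theorem stmt_14 {α : Type*} [DecidableEq α] (K : ℝ) (hK : 0 < K)
    (A B S : Finset α) (hA : A.Nonempty) (hB : B.Nonempty) (hAB : (A ∩ B).Nonempty) :
    |((A ∩ B ∩ S).card : ℝ) / ((A ∩ B).card : ℝ) - ((B ∩ S).card : ℝ) / (B.card : ℝ)| ≤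
      ((A.card : ℝ) / ((A ∩ B).card : ℝ)) *
        (|((A ∩ (B ∩ S)).card : ℝ) / (A.card : ℝ) - ((B ∩ S).card : ℝ) / K| +
          |((A ∩ B).card : ℝ) / (A.card : ℝ) - (B.card : ℝ) / K|) := by
  have ha : (0 : ℝ) < A.card := by exact_mod_cast hA.card_pos
  have hb : (0 : ℝ) < B.card := by exact_mod_cast hB.card_pos
  have hx : (0 : ℝ) < (A ∩ B).card := by exact_mod_cast hAB.card_pos
  have hs : ((B ∩ S).card : ℝ) ≤ B.card := by
    exact_mod_cast Finset.card_le_card Finset.inter_subset_left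
  rw [Finset.inter_assoc]
  generalize (A.card : ℝ) = a at *
  generalize (B.card : ℝ) = b at *
  generalize ((A ∩ B).card : ℝ) = x at *
  generalize ((A ∩ (B ∩ S)).card : ℝ) = y at *
  have hs0 : (0 : ℝ) ≤ (B ∩ S).card := Nat.cast_nonneg _
  generalize ((B ∩ S).card : ℝ) = s at *
  have key : y / x - s / b = a / x * ((y / a - s / K) - s / b * (x / a - b / K)) := by
    field_simp
    ring
  have hr : |s / b| ≤ 1 := by
    rw [abs_of_nonneg (by positivity)]
    exact (div_le_one hb).2 hs
  rw [key, abs_mul, abs_of_pos (div_pos ha hx)]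
  refine mul_le_mul_of_nonneg_left ((abs_sub _ _).trans ?_) (div_pos ha hx).le
  rw [abs_mul]
  gcongr
  exact mul_le_of_le_one_left (abs_nonneg _) hr
end
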